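/- Let F be a finite field with exactly q elements, let n ≥ 1, and let H be a subgroup of GL(n,F) containing SL(n,F). Let j denote the index of H in GL(n,F). Then k(H) = (1/j) · Σ_{d | gcd(j,n)} φ₂(d) · k(GL(n/d, F)), where the sum is over the positive divisors d of gcd(j,n). -/

import Mathlib

/-- The multiplicative function `φ₂(d) = d² ∏_{p ∣ d} (1 - p⁻²)` (Jordan's totient `J₂`). -/
noncomputable def phi2 (d : ℕ) : ℚ :=
  (d : ℚ) ^ 2 * ∏ p ∈ d.primeFactors, (1 - ((p : ℚ) ^ 2)⁻¹)

section GLConjugacy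

open Polynomial

theorem Algebra.norm_pi {K ι : Type*} [CommRing K] [Fintype ι] {A : ι → Type*}
    [∀ i, CommRing (A i)] [∀ i, Algebra K (A i)] [∀ i, Module.Finite K (A i)]
    [∀ i, Module.Free K (A i)] (x : ∀ i, A i) :
    Algebra.norm K x = ∏ i, Algebra.norm K (x i) := by
  classical
  let _ : LinearOrder ι := LinearOrder.lift' (Fintype.equivFin ι) (Fintype.equivFin ι).injective
  let b := fun i => Module.Free.chooseBasis K (A i)
  have h : Algebra.leftMulMatrix (Pi.basis b) x =
      Matrix.blockDiagonal' fun i => Algebra.leftMulMatrix (b i) (x i) := by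
    ext ⟨i, k⟩ ⟨j, l⟩
    rw [Algebra.leftMulMatrix_eq_repr_mul, Matrix.blockDiagonal'_apply, Pi.basis_repr,
      Pi.basis_apply, Pi.mul_apply]
    by_cases hij : i = j
    · subst hij
      simp [Algebra.leftMulMatrix_eq_repr_mul]
    · simp [hij]
  rw [Algebra.norm_eq_matrix_det (Pi.basis b), h,
    (Matrix.blockTriangular_blockDiagonal' _).det_fintype]
  refine Finset.prod_congr rfl fun i _ => ?_
  rw [Algebra.norm_eq_matrix_det (b i), ← Matrix.det_submatrix_equiv_self
    (Equiv.sigmaSubtype (β := fun i => Module.Free.ChooseBasisIndex K (A i)) i)]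
  congr 1
  ext ⟨⟨a, k⟩, hk⟩ ⟨⟨c, l⟩, hl⟩
  dsimp only at hk hl
  subst hk
  subst hl
  simp [Matrix.toSquareBlock_def, Matrix.blockDiagonal'_apply, Equiv.sigmaSubtype]

theorem AdjoinRoot.norm_root {K : Type*} [Field K] {f : K[X]} (hf : f.Monic) :
    Algebra.norm K (AdjoinRoot.root f) = (-1) ^ f.natDegree * f.coeff 0 := by
  have h := Algebra.PowerBasis.norm_gen_eq_coeff_zero_minpoly (AdjoinRoot.powerBasis hf.ne_zero)
  rwa [AdjoinRoot.minpoly_powerBasis_gen_of_monic hf, AdjoinRoot.powerBasis_dim,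
    AdjoinRoot.powerBasis_gen] at h

theorem AdjoinRoot.finrank_eq {K : Type*} [Field K] {f : K[X]} (hf : f.Monic) :
    Module.finrank K (AdjoinRoot f) = f.natDegree := by
  rw [(AdjoinRoot.powerBasis hf.ne_zero).finrank, AdjoinRoot.powerBasis_dim]

theorem AdjoinRoot.natCard_eq {K : Type*} [Field K] [Finite K] {f : K[X]} (hf : f.Monic) :
    Nat.card (AdjoinRoot f) = Nat.card K ^ f.natDegree := by
  have : Module.Finite K (AdjoinRoot f) := hf.finite_adjoinRoot
  rw [Module.natCard_eq_pow_finrank (K := K), AdjoinRoot.finrank_eq hf]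

theorem AdjoinRoot.natCard_torsion {K : Type*} [Field K] [Finite K] {u v : K[X]}
    (hu : u ≠ 0) (hv : v.Monic) :
    Nat.card {x : AdjoinRoot (u * v) // mk (u * v) v * x = 0} = Nat.card K ^ v.natDegree := by
  rw [← AdjoinRoot.natCard_eq hv]
  let g : K[X] →+ AdjoinRoot (u * v) :=
    (mk (u * v) : K[X] →+* _).toAddMonoidHom.comp (AddMonoidHom.mulLeft u)
  have hgv : ∀ a, g a = mk (u * v) (u * a) := fun _ => rfl
  have hs : ∀ x : AdjoinRoot (u * v), mk (u * v) v * x = 0 → ∃ a, g a = x := by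
    intro x hx
    obtain ⟨a, rfl⟩ := mk_surjective x
    rw [← map_mul, mk_eq_zero, mul_comm v a] at hx
    obtain ⟨c, rfl⟩ := (mul_dvd_mul_iff_right hv.ne_zero).1 hx
    exact ⟨c, rfl⟩
  have hk : ∀ a c, g a = g c ↔ mk v a = mk v c := by
    intro a c
    rw [hgv, hgv, mk_eq_mk, mk_eq_mk, ← mul_sub, mul_dvd_mul_iff_left hu]
  symm
  refine Nat.card_congr (Equiv.ofBijective
    (fun y => ⟨g (mk_surjective y).choose, ?_⟩) ⟨?_, ?_⟩)
  · rw [hgv, ← map_mul, mk_eq_zero]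
    exact ⟨_, by rw [← mul_assoc, mul_comm v u]⟩
  · intro y z hyz
    have := (hk _ _).1 (Subtype.ext_iff.1 hyz)
    rwa [(mk_surjective y).choose_spec, (mk_surjective z).choose_spec] at this
  · rintro ⟨x, hx⟩
    obtain ⟨a, rfl⟩ := hs x hx
    refine ⟨mk v a, Subtype.ext ?_⟩
    exact (hk _ _).2 (mk_surjective (mk v a)).choose_spec

/-- The monic irreducible polynomials different from `X`. -/
abbrev PrimePoly (F : Type*) [Field F] : Type _ :=
  {p : F[X] // p.Monic ∧ Irreducible p ∧ p.coeff 0 ≠ 0}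

theorem PrimePoly.natCard_torsion {F : Type*} [Field F] [Finite F] [DecidableEq (PrimePoly F)]
    (p r : PrimePoly F) (e k : ℕ) :
    Nat.card {x : AdjoinRoot (p.1 ^ e) // AdjoinRoot.mk (p.1 ^ e) (r.1 ^ k) * x = 0} =
      Nat.card F ^ (r.1.natDegree * if p = r then min k e else 0) := by
  split_ifs with h
  · subst h
    rcases le_total k e with hke | hke
    · obtain ⟨u, rfl⟩ := Nat.exists_eq_add_of_le' hke
      rw [pow_add, AdjoinRoot.natCard_torsion (pow_ne_zero _ p.2.1.ne_zero) (p.2.1.pow k),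
        natDegree_pow, mul_comm, min_eq_left (Nat.le_add_left _ _)]
    · have h0 : AdjoinRoot.mk (p.1 ^ e) (p.1 ^ k) = 0 :=
        AdjoinRoot.mk_eq_zero.2 (pow_dvd_pow _ hke)
      simp only [h0, zero_mul]
      rw [Nat.card_congr (Equiv.subtypeUnivEquiv fun _ => trivial),
        AdjoinRoot.natCard_eq (p.2.1.pow e), natDegree_pow, mul_comm, min_eq_right hke]
  · rw [mul_zero, pow_zero, Nat.card_eq_one_iff_unique]
    refine ⟨⟨fun x y => Subtype.ext ?_⟩, ⟨0, mul_zero _⟩⟩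
    have hc : IsCoprime (p.1 ^ e) (r.1 ^ k) := by
      refine IsCoprime.pow ((p.2.2.1.coprime_iff_not_dvd).2 fun hd => h (Subtype.ext ?_))
      exact eq_of_monic_of_associated p.2.1 r.2.1
        (p.2.2.1.associated_of_dvd r.2.2.1 hd)
    have hz : ∀ x : AdjoinRoot (p.1 ^ e), AdjoinRoot.mk (p.1 ^ e) (r.1 ^ k) * x = 0 → x = 0 := by
      intro x hx
      obtain ⟨a, rfl⟩ := AdjoinRoot.mk_surjective x
      rw [← map_mul, AdjoinRoot.mk_eq_zero] at hx
      exact AdjoinRoot.mk_eq_zero.2 (hc.dvd_of_dvd_mul_left hx)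
    rw [hz _ x.2, hz _ y.2]

section ElementaryDivisors

variable {F : Type*} [Field F] {ι κ : Type*}

/-- The product of the quotients `F[X] / (p ^ e)` over a family of pairs `(e, p)`. -/
abbrev PrimaryProd (s : ι → ℕ+ × PrimePoly F) : Type _ :=
  ∀ i, AdjoinRoot ((s i).2.1 ^ ((s i).1 : ℕ))

/-- The class of `X` in every factor of `PrimaryProd s`. -/
noncomputable def PrimaryProd.gen (s : ι → ℕ+ × PrimePoly F) : PrimaryProd s :=
  fun _ => AdjoinRoot.root _

theorem PrimaryProd.aeval_gen (s : ι → ℕ+ × PrimePoly F) (a : F[X]) (i : ι) :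
    aeval (gen s) a i = AdjoinRoot.mk ((s i).2.1 ^ ((s i).1 : ℕ)) a := by
  rw [← AdjoinRoot.aeval_eq]
  exact (aeval_algHom_apply (Pi.evalAlgHom F _ i) (gen s) a).symm

instance PrimaryProd.finite_factor (s : ι → ℕ+ × PrimePoly F) (i : ι) :
    Module.Finite F (AdjoinRoot ((s i).2.1 ^ ((s i).1 : ℕ))) :=
  ((s i).2.2.1.pow _).finite_adjoinRoot

theorem PrimaryProd.natCard_torsion [Finite F] [Fintype ι] [DecidableEq (PrimePoly F)]
    (s : ι → ℕ+ × PrimePoly F)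
    (r : PrimePoly F) (k : ℕ) :
    Nat.card {x : PrimaryProd s // aeval (gen s) (r.1 ^ k) * x = 0} =
      Nat.card F ^ (r.1.natDegree * ∑ i, if (s i).2 = r then min k (s i).1 else 0) := by
  have e : {x : PrimaryProd s // aeval (gen s) (r.1 ^ k) * x = 0} ≃
      ∀ i, {x : AdjoinRoot ((s i).2.1 ^ ((s i).1 : ℕ)) //
        AdjoinRoot.mk ((s i).2.1 ^ ((s i).1 : ℕ)) (r.1 ^ k) * x = 0} :=
    (Equiv.subtypeEquivRight fun x => by
      rw [funext_iff]
      exact forall_congr' fun i => by rw [Pi.mul_apply, PrimaryProd.aeval_gen]; rfl).trans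
      Equiv.subtypePiEquivPi
  rw [Nat.card_congr e, Nat.card_pi, Finset.mul_sum, ← Finset.prod_pow_eq_pow_sum]
  refine Finset.prod_congr rfl fun i _ => ?_
  rw [PrimePoly.natCard_torsion]

theorem PrimaryProd.map_aeval_mul {s : ι → ℕ+ × PrimePoly F} {t : κ → ℕ+ × PrimePoly F}
    (φ : PrimaryProd s →ₗ[F] PrimaryProd t) (hφ : ∀ x, φ (gen s * x) = gen t * φ x)
    (a : F[X]) (x : PrimaryProd s) : φ (aeval (gen s) a * x) = aeval (gen t) a * φ x := by
  induction a using Polynomial.induction_on' with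
  | add a b ha hb => simp only [map_add, add_mul, ha, hb]
  | monomial n c =>
    simp only [aeval_monomial, ← Algebra.smul_def, smul_mul_assoc, map_smul]
    congr 1
    induction n with
    | zero => simp
    | succ n ih => rw [pow_succ', mul_assoc, hφ, ih, pow_succ', mul_assoc]

theorem PrimaryProd.two_mul_sum_min [Fintype ι] [DecidableEq (PrimePoly F)]
    (u : ι → ℕ+ × PrimePoly F) (e : ℕ+) (r : PrimePoly F) :
    2 * (∑ i, if (u i).2 = r then min (e : ℕ) (u i).1 else 0) =
      (∑ i, if (u i).2 = r then min ((e : ℕ) - 1) (u i).1 else 0) +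
      (∑ i, if (u i).2 = r then min ((e : ℕ) + 1) (u i).1 else 0) +
      (Finset.univ.val.map u).count (e, r) := by
  rw [Multiset.count_map, Finset.mul_sum, ← Finset.sum_add_distrib,
    ← Finset.filter_val, Finset.card_val, Finset.card_filter, ← Finset.sum_add_distrib]
  refine Finset.sum_congr rfl fun i _ => ?_
  have he := e.pos
  have hu := (u i).1.pos
  have : (e, r) = u i ↔ (u i).2 = r ∧ ((u i).1 : ℕ) = e := by
    rw [Prod.ext_iff, PNat.coe_inj]
    exact ⟨fun h => ⟨h.2.symm, h.1.symm⟩, fun h => ⟨h.2.symm, h.1.symm⟩⟩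
  by_cases h : (u i).2 = r
  · simp only [this, h, true_and, if_true]
    split_ifs <;> omega
  · simp [this, h]

theorem PrimaryProd.multiset_map_eq [Finite F] [Fintype ι] [Fintype κ]
    {s : ι → ℕ+ × PrimePoly F} {t : κ → ℕ+ × PrimePoly F}
    (φ : PrimaryProd s ≃ₗ[F] PrimaryProd t) (hφ : ∀ x, φ (gen s * x) = gen t * φ x) :
    Finset.univ.val.map s = Finset.univ.val.map t := by
  classical
  have key : ∀ (r : PrimePoly F) (k : ℕ), (∑ i, if (s i).2 = r then min k (s i).1 else 0) =
      ∑ i, if (t i).2 = r then min k (t i).1 else 0 := by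
    intro r k
    have h : Nat.card {x : PrimaryProd s // aeval (gen s) (r.1 ^ k) * x = 0} =
        Nat.card {x : PrimaryProd t // aeval (gen t) (r.1 ^ k) * x = 0} :=
      Nat.card_congr (φ.toEquiv.subtypeEquiv fun x => by
        change _ ↔ _ * φ x = 0
        have := PrimaryProd.map_aeval_mul φ.toLinearMap hφ (r.1 ^ k) x
        simp only [LinearEquiv.coe_coe] at this
        rw [← this]
        exact (LinearEquiv.map_eq_zero_iff φ).symm)
    rw [PrimaryProd.natCard_torsion, PrimaryProd.natCard_torsion] at h
    exact Nat.eq_of_mul_eq_mul_left r.2.2.1.natDegree_pos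
      (Nat.pow_right_injective Finite.one_lt_card h)
  ext ⟨e, r⟩
  have h1 := two_mul_sum_min s e r
  have h2 := two_mul_sum_min t e r
  rw [key, key, key] at h1
  omega

end ElementaryDivisors

theorem AdjoinRoot.exists_quotient_linearEquiv {F : Type*} [Field F] {f g : F[X]}
    (h : Associated f g) :
    ∃ c : (F[X] ⧸ Submodule.span F[X] {f}) ≃ₗ[F] AdjoinRoot g,
      ∀ x, c ((X : F[X]) • x) = AdjoinRoot.root g * c x := by
  have hs : Submodule.span F[X] {f} = Ideal.span {g} :=
    Ideal.span_singleton_eq_span_singleton.2 h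
  refine ⟨(Submodule.quotEquivOfEq _ _ hs).restrictScalars F, fun x => ?_⟩
  obtain ⟨a, rfl⟩ := Submodule.Quotient.mk_surjective _ x
  rfl

section Model

open Matrix

variable {F : Type*} [Field F] {ι κ : Type*} {n : ℕ}

/-- The matrix `y` has the family `s` of pairs (exponent, prime) as elementary divisors. -/
def HasElementaryDivisors (y : Matrix (Fin n) (Fin n) F) (s : ι → ℕ+ × PrimePoly F) : Prop :=
  ∃ φ : (Fin n → F) ≃ₗ[F] PrimaryProd s, ∀ v, φ (y *ᵥ v) = PrimaryProd.gen s * φ v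

theorem HasElementaryDivisors.reindex {y : Matrix (Fin n) (Fin n) F} {s : ι → ℕ+ × PrimePoly F}
    (h : HasElementaryDivisors y s) (e : κ ≃ ι) : HasElementaryDivisors y (s ∘ e) := by
  obtain ⟨φ, hφ⟩ := h
  refine ⟨φ.trans (LinearEquiv.piCongrLeft F
    (fun i => AdjoinRoot ((s i).2.1 ^ ((s i).1 : ℕ))) e).symm, fun v => ?_⟩
  rw [LinearEquiv.trans_apply, LinearEquiv.trans_apply, hφ]
  rfl

theorem HasElementaryDivisors.isConj {y z : GL (Fin n) F} {s : ι → ℕ+ × PrimePoly F}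
    (hy : HasElementaryDivisors y.1 s) (hz : HasElementaryDivisors z.1 s) : IsConj y z := by
  obtain ⟨φ, hφ⟩ := hy
  obtain ⟨ψ, hψ⟩ := hz
  rw [isConj_iff]
  let e := φ.trans ψ.symm
  let g : GL (Fin n) F := Matrix.GeneralLinearGroup.toLin.symm
    (LinearMap.GeneralLinearGroup.ofLinearEquiv e)
  have hg : ∀ v, g.1 *ᵥ v = e v := fun v => by
    change LinearMap.toMatrix' (e : (Fin n → F) →ₗ[F] (Fin n → F)) *ᵥ v = e v
    rw [LinearMap.toMatrix'_mulVec]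
    rfl
  refine ⟨g, mul_inv_eq_iff_eq_mul.2 (Units.ext (Matrix.ext_of_mulVec_single fun i => ?_))⟩
  rw [Units.val_mul, Units.val_mul, ← Matrix.mulVec_mulVec, ← Matrix.mulVec_mulVec, hg, hg]
  apply ψ.injective
  rw [hψ]
  simp only [e, LinearEquiv.trans_apply, LinearEquiv.apply_symm_apply, hφ]

theorem HasElementaryDivisors.of_isConj {y z : GL (Fin n) F} {s : ι → ℕ+ × PrimePoly F}
    (hy : HasElementaryDivisors y.1 s) (h : IsConj y z) : HasElementaryDivisors z.1 s := by
  obtain ⟨φ, hφ⟩ := hy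
  obtain ⟨g, hg⟩ := isConj_iff.1 h
  let e : (Fin n → F) ≃ₗ[F] (Fin n → F) :=
    LinearMap.GeneralLinearGroup.toLinearEquiv (Matrix.GeneralLinearGroup.toLin g⁻¹)
  have he : ∀ v, e v = (g⁻¹).1 *ᵥ v := fun v => rfl
  refine ⟨e.trans φ, fun v => ?_⟩
  rw [LinearEquiv.trans_apply, LinearEquiv.trans_apply, ← hφ, he, he, Matrix.mulVec_mulVec,
    Matrix.mulVec_mulVec, ← Units.val_mul, ← Units.val_mul, ← hg]
  congr 3
  group

/-- The determinant of multiplication by `X` on `F[X] / p`. -/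
noncomputable def PrimePoly.weight (p : PrimePoly F) : Fˣ :=
  (-1) ^ p.1.natDegree * Units.mk0 (p.1.coeff 0) p.2.2.2

theorem HasElementaryDivisors.det [Fintype ι] {y : Matrix (Fin n) (Fin n) F}
    {s : ι → ℕ+ × PrimePoly F} (hy : HasElementaryDivisors y s) :
    y.det = ((∏ i, (s i).2.weight ^ ((s i).1 : ℕ) : Fˣ) : F) := by
  obtain ⟨φ, hφ⟩ := hy
  have h1 : LinearMap.det (Matrix.toLin' y) = Algebra.norm F (PrimaryProd.gen s) := by
    rw [Algebra.norm_apply, ← LinearMap.det_conj (Matrix.toLin' y) φ]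
    congr 1
    ext v i
    have := hφ (φ.symm v)
    simp only [LinearMap.comp_apply, LinearEquiv.coe_coe, Matrix.toLin'_apply, this]
    simp
  rw [LinearMap.det_toLin'] at h1
  rw [h1, Algebra.norm_pi, Units.coe_prod]
  refine Finset.prod_congr rfl fun i _ => ?_
  rw [PrimaryProd.gen, AdjoinRoot.norm_root ((s i).2.2.1.pow _), natDegree_pow]
  simp [PrimePoly.weight, mul_pow, coeff_zero_eq_eval_zero, pow_mul']

theorem PrimaryProd.finrank [Fintype ι] (s : ι → ℕ+ × PrimePoly F) :
    Module.finrank F (PrimaryProd s) = ∑ i, (s i).1 * (s i).2.1.natDegree := by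
  rw [Module.finrank_pi_fintype]
  exact Finset.sum_congr rfl fun i _ => by
    rw [AdjoinRoot.finrank_eq ((s i).2.2.1.pow _), natDegree_pow]

theorem HasElementaryDivisors.sum_eq [Fintype ι] {y : Matrix (Fin n) (Fin n) F}
    {s : ι → ℕ+ × PrimePoly F} (hy : HasElementaryDivisors y s) :
    ∑ i, (s i).1 * (s i).2.1.natDegree = n := by
  obtain ⟨φ, -⟩ := hy
  rw [← PrimaryProd.finrank, ← φ.finrank_eq, Module.finrank_fin_fun]

theorem HasElementaryDivisors.exists_of_sum_eq [Fintype ι] (s : ι → ℕ+ × PrimePoly F)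
    (hs : ∑ i, (s i).1 * (s i).2.1.natDegree = n) :
    ∃ y : GL (Fin n) F, HasElementaryDivisors y.1 s := by
  have hr : Module.finrank F (Fin n → F) = Module.finrank F (PrimaryProd s) := by
    rw [PrimaryProd.finrank, hs, Module.finrank_fin_fun]
  let φ : (Fin n → F) ≃ₗ[F] PrimaryProd s := LinearEquiv.ofFinrankEq _ _ hr
  let y := LinearMap.toMatrix' ((φ.symm : PrimaryProd s →ₗ[F] (Fin n → F)) ∘ₗ
    LinearMap.mulLeft F (PrimaryProd.gen s) ∘ₗ (φ : (Fin n → F) →ₗ[F] PrimaryProd s))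
  have hy : HasElementaryDivisors y s := ⟨φ, fun v => by
    rw [LinearMap.toMatrix'_mulVec]
    simp⟩
  exact ⟨Matrix.GeneralLinearGroup.mkOfDetNeZero y (hy.det ▸ Units.ne_zero _), hy⟩

theorem HasElementaryDivisors.multiset_map_eq [Finite F] [Fintype ι] [Fintype κ]
    {y : Matrix (Fin n) (Fin n) F} {s : ι → ℕ+ × PrimePoly F} {t : κ → ℕ+ × PrimePoly F}
    (hs : HasElementaryDivisors y s) (ht : HasElementaryDivisors y t) :
    Finset.univ.val.map s = Finset.univ.val.map t := by
  obtain ⟨φ, hφ⟩ := hs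
  obtain ⟨ψ, hψ⟩ := ht
  refine PrimaryProd.multiset_map_eq (φ.symm.trans ψ) fun x => ?_
  obtain ⟨v, rfl⟩ := φ.surjective x
  rw [← hφ, LinearEquiv.trans_apply, LinearEquiv.trans_apply, LinearEquiv.symm_apply_apply,
    LinearEquiv.symm_apply_apply, hψ]

universe u in
theorem exists_hasElementaryDivisors {F : Type u} [Field F] (y : GL (Fin n) F) :
    ∃ (ι : Type u) (_ : Fintype ι) (s : ι → ℕ+ × PrimePoly F), HasElementaryDivisors y.1 s := by
  classical
  let T : Module.End F (Fin n → F) := Matrix.toLin' y.1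
  obtain ⟨ι, _, p, hp, e, ⟨E⟩⟩ := Module.equiv_directSum_of_isTorsion
    (Module.AEval.isTorsion_of_finiteDimensional F (Fin n → F) T)
  let E' := E.trans (DirectSum.linearEquivFunOnFintype F[X] ι _)
  let Φ : (Fin n → F) ≃ₗ[F] ∀ i, F[X] ⧸ Submodule.span F[X] {p i ^ e i} :=
    (Module.AEval'.of T).trans (E'.restrictScalars F)
  have hΦ : ∀ v, Φ (y.1 *ᵥ v) = (X : F[X]) • Φ v := by
    intro v
    have : Module.AEval'.of T (y.1 *ᵥ v) = (X : F[X]) • Module.AEval'.of T v :=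
      (Module.AEval'.X_smul_of T v).symm
    simp only [Φ, LinearEquiv.trans_apply, this]
    exact E'.map_smul _ _
  have hX : ∀ z : ∀ i, F[X] ⧸ Submodule.span F[X] {p i ^ e i}, (X : F[X]) • z = 0 → z = 0 := by
    intro z hz
    obtain ⟨v, rfl⟩ := Φ.surjective z
    rw [← hΦ, LinearEquiv.map_eq_zero_iff] at hz
    have : v = (y⁻¹).1 *ᵥ (y.1 *ᵥ v) := by
      rw [Matrix.mulVec_mulVec, ← Units.val_mul, inv_mul_cancel, Units.val_one, Matrix.one_mulVec]
    rw [this, hz, Matrix.mulVec_zero, map_zero]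
  have hcoeff : ∀ i, e i ≠ 0 → (p i).coeff 0 ≠ 0 := by
    intro i hi h0
    obtain ⟨a, ha⟩ := (X_dvd_iff.2 h0).trans (dvd_pow_self (p i) hi)
    have hz := hX (Pi.single i (Submodule.Quotient.mk a)) (by
      rw [← Pi.single_smul, ← Submodule.Quotient.mk_smul, smul_eq_mul, ← ha,
        (Submodule.Quotient.mk_eq_zero _).2 (Submodule.mem_span_singleton_self _), Pi.single_zero])
    rw [Pi.single_eq_zero_iff, Submodule.Quotient.mk_eq_zero, Submodule.mem_span_singleton] at hz
    obtain ⟨c, hc⟩ := hz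
    rw [ha, smul_eq_mul] at hc
    have ha0 : a ≠ 0 := by
      rintro rfl
      rw [mul_zero] at ha
      exact pow_ne_zero _ (hp i).ne_zero ha
    have : c * X = 1 := mul_right_cancel₀ ha0 (by rw [one_mul, mul_assoc, hc])
    exact not_isUnit_X (IsUnit.of_mul_eq_one_right _ this)
  let s : {i // e i ≠ 0} → ℕ+ × PrimePoly F := fun i =>
    (⟨e i, Nat.pos_of_ne_zero i.2⟩, ⟨normalize (p i), monic_normalize (hp i).ne_zero,
      (normalize_associated (p i)).symm.irreducible (hp i), by
        rw [normalize_apply, coe_normUnit, coeff_mul_C]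
        exact mul_ne_zero (hcoeff i i.2) (by simp [(hp i).ne_zero])⟩)
  have hc : ∀ i : {i // e i ≠ 0}, Associated (p i ^ e i) ((s i).2.1 ^ ((s i).1 : ℕ)) :=
    fun i => (normalize_associated (p i)).symm.pow_pow
  choose c hc' using fun i => AdjoinRoot.exists_quotient_linearEquiv (hc i)
  have hsub : ∀ i, e i = 0 → Subsingleton (F[X] ⧸ Submodule.span F[X] {p i ^ e i}) := by
    intro i hi
    rw [hi, pow_zero, Submodule.Quotient.subsingleton_iff]
    exact Ideal.span_singleton_one
  let ρ : (∀ i, F[X] ⧸ Submodule.span F[X] {p i ^ e i}) →ₗ[F] PrimaryProd s :=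
    LinearMap.pi fun i => (c i).toLinearMap ∘ₗ LinearMap.proj (i : ι)
  have hρ : ∀ z i, ρ z i = c i (z i) := fun z i => rfl
  have hρb : Function.Bijective ρ := by
    constructor
    · intro z w h
      funext i
      by_cases hi : e i = 0
      · exact (hsub i hi).elim _ _
      · exact (c ⟨i, hi⟩).injective (congrFun h ⟨i, hi⟩)
    · intro z
      refine ⟨fun i => if hi : e i ≠ 0 then (c ⟨i, hi⟩).symm (z ⟨i, hi⟩) else 0, ?_⟩
      funext i
      rw [hρ, dif_pos i.2, LinearEquiv.apply_symm_apply]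
  refine ⟨_, inferInstance, s, Φ.trans (LinearEquiv.ofBijective ρ hρb), fun v => ?_⟩
  change ρ (Φ (y.1 *ᵥ v)) = PrimaryProd.gen s * ρ (Φ v)
  rw [hΦ]
  funext i
  exact hc' i _

end Model

theorem Multiset.exists_equiv_of_map_univ_eq {ι κ α : Type*} [Fintype ι] [Fintype κ]
    {s : ι → α} {t : κ → α} (h : Finset.univ.val.map s = Finset.univ.val.map t) :
    ∃ e : ι ≃ κ, s = t ∘ e := by
  classical
  have hc : ∀ a, Nonempty ({i // s i = a} ≃ {i // t i = a}) := by
    intro a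
    refine Fintype.card_eq.1 ?_
    have := congrArg (Multiset.count a) h
    simpa only [Multiset.count_map, ← Finset.filter_val, Finset.card_val, eq_comm (a := a),
      ← Fintype.card_subtype] using this
  refine ⟨Equiv.ofFiberEquiv fun a => (hc a).some, ?_⟩
  funext i
  exact (Equiv.ofFiberEquiv_map _ i).symm

section ElementaryDivisorData

variable {F : Type*} [Field F]

/-- The total degree of a multiset of primes. -/
noncomputable def primeDeg : Multiset (PrimePoly F) →+ ℕ :=
  Multiset.sumAddMonoidHom.comp (Multiset.mapAddMonoidHom fun p => p.1.natDegree)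

/-- The total weight of a multiset of primes. -/
noncomputable def primeWeight : Multiset (PrimePoly F) →+ Additive Fˣ :=
  Multiset.sumAddMonoidHom.comp (Multiset.mapAddMonoidHom fun p => Additive.ofMul p.weight)

variable (F) in
/-- For every exponent `e`, the multiset of primes `p` such that `p ^ e` is an elementary
divisor. -/
abbrev DivisorData : Type _ := ℕ+ →₀ Multiset (PrimePoly F)

namespace DivisorData

/-- The dimension of the module with the given elementary divisors. -/
noncomputable def deg : DivisorData F →+ ℕ :=
  Finsupp.liftAddHom fun e => (AddMonoidHom.mulLeft (e : ℕ)).comp primeDeg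

/-- The determinant of `X` on the module with the given elementary divisors. -/
noncomputable def weight : DivisorData F →+ Additive Fˣ :=
  Finsupp.liftAddHom fun e => (e : ℕ) • primeWeight (F := F)

open Classical in
variable (F) in
/-- Sorting a multiset of pairs (exponent, prime) by exponent. -/
noncomputable def ofMultiset : Multiset (ℕ+ × PrimePoly F) ≃+ DivisorData F :=
  (Multiset.toFinsupp.trans Finsupp.curryAddEquiv).trans
    (Finsupp.mapRange.addEquiv Multiset.toFinsupp.symm)

theorem ofMultiset_singleton (e : ℕ+) (p : PrimePoly F) :
    ofMultiset F {(e, p)} = Finsupp.single e {p} := by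
  simp [ofMultiset, Multiset.toFinsupp_singleton]

theorem deg_ofMultiset (m : Multiset (ℕ+ × PrimePoly F)) :
    deg (ofMultiset F m) = (m.map fun x => (x.1 : ℕ) * x.2.1.natDegree).sum := by
  induction m using Multiset.induction_on with
  | empty => simp
  | cons x m ih =>
    rw [← Multiset.singleton_add, map_add, map_add, ih, Multiset.map_add, Multiset.sum_add,
      ofMultiset_singleton]
    simp [deg, primeDeg]

theorem weight_ofMultiset (m : Multiset (ℕ+ × PrimePoly F)) :
    (weight (ofMultiset F m)).toMul = (m.map fun x => x.2.weight ^ (x.1 : ℕ)).prod := by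
  induction m using Multiset.induction_on with
  | empty => simp
  | cons x m ih =>
    rw [← Multiset.singleton_add, map_add, map_add, toMul_add, ih, Multiset.map_add,
      Multiset.prod_add, ofMultiset_singleton]
    simp [weight, primeWeight]

theorem exists_classification [Finite F] (n : ℕ) :
    ∃ Φ : GL (Fin n) F → {h : DivisorData F // deg h = n}, Function.Surjective Φ ∧
      (∀ y z, Φ y = Φ z ↔ IsConj y z) ∧
      ∀ y, Matrix.GeneralLinearGroup.det y = (weight (Φ y).1).toMul := by
  classical
  choose ι _ s hs using fun y : GL (Fin n) F => exists_hasElementaryDivisors y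
  let m : GL (Fin n) F → Multiset (ℕ+ × PrimePoly F) := fun y => Finset.univ.val.map (s y)
  have hdeg : ∀ y, deg (ofMultiset F (m y)) = n := fun y => by
    rw [deg_ofMultiset, Multiset.map_map]
    exact (hs y).sum_eq
  have key : ∀ y z, m y = m z → IsConj y z := by
    intro y z h
    obtain ⟨e, he⟩ := Multiset.exists_equiv_of_map_univ_eq h
    exact (he ▸ hs y).isConj ((hs z).reindex e)
  refine ⟨fun y => ⟨ofMultiset F (m y), hdeg y⟩, ?_, fun y z => ?_, fun y => ?_⟩
  · rintro ⟨d, hd⟩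
    obtain ⟨k, rfl⟩ := (ofMultiset F).surjective d
    rw [deg_ofMultiset] at hd
    obtain ⟨y, hy⟩ := HasElementaryDivisors.exists_of_sum_eq (n := n)
      (fun i : k.ToType => i.1) (by
        rw [← hd]
        conv_rhs => rw [← Multiset.map_univ_coe k, Multiset.map_map]
        rfl)
    refine ⟨y, Subtype.ext ?_⟩
    change ofMultiset F (m y) = _
    simp only [m]
    rw [(hs y).multiset_map_eq hy, Multiset.map_univ_coe]
  · rw [Subtype.mk.injEq, (ofMultiset F).apply_eq_iff_eq]
    exact ⟨key y z, fun h => ((hs y).of_isConj h).multiset_map_eq (hs z)⟩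
  · refine Units.ext ?_
    rw [weight_ofMultiset, Multiset.map_map]
    exact (hs y).det

end DivisorData

end ElementaryDivisorData

section ScaleConst

variable {F : Type*} [Field F]

open Classical in
/-- Multiply the constant coefficient by `g`, leaving the polynomial `1` unchanged. -/
noncomputable def Polynomial.scaleConst (g : Fˣ) (f : F[X]) : F[X] :=
  if f = 1 then 1 else f + C ((g - 1) * f.coeff 0)

theorem Polynomial.scaleConst_one (g : Fˣ) : scaleConst g (1 : F[X]) = 1 := if_pos rfl

theorem Polynomial.natDegree_scaleConst (g : Fˣ) (f : F[X]) :
    (scaleConst g f).natDegree = f.natDegree := by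
  unfold scaleConst
  split_ifs with h
  · rw [h]
  · exact natDegree_add_C

theorem Polynomial.Monic.scaleConst {f : F[X]} (hf : f.Monic) (g : Fˣ) :
    (scaleConst g f).Monic := by
  unfold Polynomial.scaleConst
  split_ifs with h
  · exact monic_one
  · refine hf.add_of_left (degree_C_le.trans_lt ?_)
    exact natDegree_pos_iff_degree_pos.1 (Nat.pos_of_ne_zero fun h0 =>
      h (hf.natDegree_eq_zero.1 h0))

theorem Polynomial.coeff_zero_scaleConst (g : Fˣ) {f : F[X]} (hf : f ≠ 1) :
    (scaleConst g f).coeff 0 = g * f.coeff 0 := by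
  rw [scaleConst, if_neg hf, coeff_add, coeff_C_zero]
  ring

theorem Polynomial.Monic.scaleConst_ne_one {f : F[X]} (hf : f.Monic) (g : Fˣ) (h1 : f ≠ 1) :
    Polynomial.scaleConst g f ≠ 1 := fun h => h1 <| hf.natDegree_eq_zero.1 <| by
  rw [← natDegree_scaleConst g, h, natDegree_one]

theorem Polynomial.Monic.scaleConst_scaleConst {f : F[X]} (hf : f.Monic) (g k : Fˣ)
    (hgk : k * g = 1) : Polynomial.scaleConst k (Polynomial.scaleConst g f) = f := by
  by_cases h : f = 1
  · rw [h, scaleConst_one, scaleConst_one]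
  · rw [Polynomial.scaleConst, if_neg (hf.scaleConst_ne_one g h), coeff_zero_scaleConst g h,
      Polynomial.scaleConst, if_neg h, add_assoc, ← C_add]
    have hgk' : (k : F) * g = 1 := by rw [← Units.val_mul, hgk, Units.val_one]
    have : ((g : F) - 1) * f.coeff 0 + (k - 1) * (g * f.coeff 0) = 0 := by
      linear_combination f.coeff 0 * hgk'
    rw [this, C_0, add_zero]

/-- Monic polynomials with nonzero constant coefficient. -/
abbrev MonicNonvanishing (F : Type*) [Field F] : Type _ :=
  {f : F[X] // f.Monic ∧ f.coeff 0 ≠ 0}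

/-- Scaling the constant coefficient as a permutation. -/
noncomputable def MonicNonvanishing.scaleConst (g : Fˣ) :
    Equiv.Perm (MonicNonvanishing F) where
  toFun f := ⟨Polynomial.scaleConst g f.1, f.2.1.scaleConst g, by
    by_cases h : f.1 = 1
    · simp [h, scaleConst_one]
    · rw [coeff_zero_scaleConst g h]
      exact mul_ne_zero g.ne_zero f.2.2⟩
  invFun f := ⟨Polynomial.scaleConst g⁻¹ f.1, f.2.1.scaleConst g⁻¹, by
    by_cases h : f.1 = 1
    · simp [h, scaleConst_one]
    · rw [coeff_zero_scaleConst g⁻¹ h]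
      exact mul_ne_zero (Units.ne_zero _) f.2.2⟩
  left_inv f := Subtype.ext (f.2.1.scaleConst_scaleConst _ _ (inv_mul_cancel g))
  right_inv f := Subtype.ext (f.2.1.scaleConst_scaleConst _ _ (mul_inv_cancel g))

/-- The product of a multiset of primes. -/
noncomputable def primeProd (m : Multiset (PrimePoly F)) : MonicNonvanishing F :=
  ⟨(m.map Subtype.val).prod, monic_multiset_prod_of_monic _ _ fun p _ => p.2.1, by
    rw [coeff_zero_multiset_prod, Multiset.map_map]
    refine Multiset.prod_ne_zero fun h => ?_
    obtain ⟨p, -, hp⟩ := Multiset.mem_map.1 h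
    exact p.2.2.2 hp⟩

theorem primeProd_bijective : Function.Bijective (primeProd (F := F)) := by
  classical
  constructor
  · intro m k h
    have h' : (m.map Subtype.val).prod = (k.map Subtype.val).prod := Subtype.ext_iff.1 h
    have key : ∀ m : Multiset (PrimePoly F),
        UniqueFactorizationMonoid.normalizedFactors (m.map Subtype.val).prod =
          m.map Subtype.val := by
      intro m
      rw [UniqueFactorizationMonoid.normalizedFactors_prod_eq, Multiset.map_map]
      · exact Multiset.map_congr rfl fun p _ => p.2.1.normalize_eq_self
      · intro a ha
        obtain ⟨p, -, rfl⟩ := Multiset.mem_map.1 ha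
        exact p.2.2.1
    refine Multiset.map_injective Subtype.val_injective ?_
    rw [← key m, h', key k]
  · rintro ⟨f, hf, hf0⟩
    have hp : ∀ p ∈ UniqueFactorizationMonoid.normalizedFactors f,
        p.Monic ∧ Irreducible p ∧ p.coeff 0 ≠ 0 := by
      intro p hp
      have hi := UniqueFactorizationMonoid.irreducible_of_normalized_factor p hp
      refine ⟨?_, hi, fun h0 => hf0 ?_⟩
      · rw [← UniqueFactorizationMonoid.normalize_normalized_factor p hp]
        exact monic_normalize hi.ne_zero
      · rw [← X_dvd_iff] at h0 ⊢
        exact h0.trans (UniqueFactorizationMonoid.dvd_of_mem_normalizedFactors hp)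
    refine ⟨(UniqueFactorizationMonoid.normalizedFactors f).attach.map
      fun p => ⟨p.1, hp p.1 p.2⟩, Subtype.ext ?_⟩
    change (Multiset.map _ (Multiset.map _ _)).prod = f
    rw [Multiset.map_map]
    simp only [Function.comp_def, Multiset.attach_map_val]
    rw [UniqueFactorizationMonoid.prod_normalizedFactors_eq hf.ne_zero, hf.normalize_eq_self]

theorem natDegree_primeProd (m : Multiset (PrimePoly F)) :
    (primeProd m).1.natDegree = primeDeg m := by
  simp only [primeProd]
  rw [natDegree_multiset_prod_of_monic]
  · simp [primeDeg, Multiset.map_map]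
  · intro a ha
    obtain ⟨p, -, rfl⟩ := Multiset.mem_map.1 ha
    exact p.2.1

theorem coeff_zero_primeProd (m : Multiset (PrimePoly F)) :
    (-1) ^ primeDeg m * (primeProd m).1.coeff 0 = ((primeWeight m).toMul : F) := by
  induction m using Multiset.induction_on with
  | empty => simp [primeProd]
  | cons p m ih =>
    rw [← Multiset.singleton_add, map_add, map_add, toMul_add, Units.val_mul, ← ih]
    simp [primeProd, mul_coeff_zero, primeWeight, primeDeg, PrimePoly.weight, pow_add]
    ring

theorem exists_primeWeight_perm (g : Fˣ) :
    ∃ τ : Equiv.Perm (Multiset (PrimePoly F)), (∀ m, τ m = 0 ↔ m = 0) ∧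
      ∀ m, m ≠ 0 → primeDeg (τ m) = primeDeg m ∧
        primeWeight (τ m) = Additive.ofMul g + primeWeight m := by
  let B := Equiv.ofBijective _ (primeProd_bijective (F := F))
  have hB : ∀ m, B m = primeProd m := fun _ => rfl
  let τ : Equiv.Perm (Multiset (PrimePoly F)) :=
    (B.trans (MonicNonvanishing.scaleConst g)).trans B.symm
  have hτ : ∀ m, (primeProd (τ m)).1 = scaleConst g (primeProd m).1 := fun m => by
    rw [← hB, ← hB]
    simp only [τ, Equiv.trans_apply, Equiv.apply_symm_apply]
    rfl
  have hd : ∀ m, primeDeg (τ m) = primeDeg m := fun m => by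
    rw [← natDegree_primeProd, hτ, natDegree_scaleConst, natDegree_primeProd]
  have h1 : ∀ m, m ≠ 0 → (primeProd m).1 ≠ 1 := fun m hm h => hm <|
    (primeProd_bijective (F := F)).1 <| Subtype.ext <| by rw [h]; simp [primeProd]
  have h0 : τ 0 = 0 := (primeProd_bijective (F := F)).1 <| Subtype.ext <| by
    rw [hτ]; simp [primeProd, scaleConst_one]
  refine ⟨τ, fun m => ⟨fun h => τ.injective (h.trans h0.symm), fun h => h ▸ h0⟩,
    fun m hm => ⟨hd m, ?_⟩⟩
  apply Additive.toMul.injective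
  rw [toMul_add]
  refine Units.ext ?_
  rw [Units.val_mul, ← coeff_zero_primeProd, ← coeff_zero_primeProd, hd, hτ,
    coeff_zero_scaleConst g (h1 m hm), toMul_ofMul]
  ring

end ScaleConst

namespace DivisorData

variable {F : Type*} [Field F]

theorem deg_single (e : ℕ+) (m : Multiset (PrimePoly F)) :
    deg (Finsupp.single e m) = e * primeDeg m := by
  simp [deg]

theorem weight_single (e : ℕ+) (m : Multiset (PrimePoly F)) :
    weight (Finsupp.single e m) = (e : ℕ) • primeWeight m := by
  simp [weight]

/-- Apply a permutation to the component of exponent `e`. -/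
noncomputable def updatePerm (e : ℕ+) (τ : Equiv.Perm (Multiset (PrimePoly F))) :
    Equiv.Perm (DivisorData F) where
  toFun h := h.update e (τ (h e))
  invFun h := h.update e (τ.symm (h e))
  left_inv h := by ext1 i; by_cases hi : i = e <;> simp [hi]
  right_inv h := by ext1 i; by_cases hi : i = e <;> simp [hi]

theorem updatePerm_apply (e : ℕ+) (τ : Equiv.Perm (Multiset (PrimePoly F))) (h : DivisorData F) :
    updatePerm e τ h = h.erase e + Finsupp.single e (τ (h e)) :=
  Finsupp.update_eq_erase_add_single _ _ _

theorem updatePerm_apply_self (e : ℕ+) (τ : Equiv.Perm (Multiset (PrimePoly F)))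
    (h : DivisorData F) : updatePerm e τ h e = τ (h e) := by
  simp [updatePerm]

/-- The value of a character on the weight. -/
noncomputable def eval (χ : Fˣ →* ℂˣ) (h : DivisorData F) : ℂ := (χ (weight h).toMul : ℂˣ)

theorem eval_add (χ : Fˣ →* ℂˣ) (h k : DivisorData F) : eval χ (h + k) = eval χ h * eval χ k := by
  simp [eval]

theorem eval_single (χ : Fˣ →* ℂˣ) (e : ℕ+) (m : Multiset (PrimePoly F)) :
    eval χ (Finsupp.single e m) = (χ (primeWeight m).toMul : ℂ) ^ (e : ℕ) := by
  simp [eval, weight_single]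

theorem sum_eval_eq_zero (χ : Fˣ →* ℂˣ) (g : Fˣ) (e : ℕ+) (he : χ g ^ (e : ℕ) ≠ 1)
    (s : Finset (DivisorData F)) (n : ℕ) (P : (ℕ+ → Multiset (PrimePoly F)) → Prop)
    (hP : ∀ (h : DivisorData F) m, P (h.update e m) ↔ P h)
    (hs : ∀ h, h ∈ s ↔ deg h = n ∧ P h ∧ h e ≠ 0) : ∑ h ∈ s, eval χ h = 0 := by
  obtain ⟨τ, hτ0, hτ⟩ := exists_primeWeight_perm g
  have hd : ∀ h, h e ≠ 0 → deg (updatePerm e τ h) = deg h := by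
    intro h hh
    conv_rhs => rw [← Finsupp.erase_add_single e h]
    rw [updatePerm_apply, map_add, map_add, deg_single, deg_single, (hτ _ hh).1]
  have hv : ∀ h, h e ≠ 0 → eval χ (updatePerm e τ h) = (χ g : ℂ) ^ (e : ℕ) * eval χ h := by
    intro h hh
    conv_rhs => rw [← Finsupp.erase_add_single e h]
    rw [updatePerm_apply, eval_add, eval_add, eval_single, eval_single, (hτ _ hh).2, toMul_add,
      toMul_ofMul, map_mul, Units.val_mul, mul_pow]
    ring
  have hmem : ∀ h, h ∈ s ↔ updatePerm e τ h ∈ s := by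
    intro h
    rw [hs, hs, updatePerm_apply_self, ne_eq, ne_eq, hτ0]
    have : P (updatePerm e τ h) ↔ P h := hP h _
    rw [this]
    constructor
    · rintro ⟨h1, h2, h3⟩
      exact ⟨(hd h h3).trans h1, h2, h3⟩
    · rintro ⟨h1, h2, h3⟩
      exact ⟨(hd h h3).symm.trans h1, h2, h3⟩
  have key : ∑ h ∈ s, eval χ h = (χ g : ℂ) ^ (e : ℕ) * ∑ h ∈ s, eval χ h := by
    conv_lhs => rw [← Finset.sum_equiv (updatePerm e τ) hmem (fun _ _ => rfl)]
    rw [Finset.mul_sum]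
    exact Finset.sum_congr rfl fun h hh => hv h ((hs h).1 hh).2.2
  have hne : (χ g : ℂ) ^ (e : ℕ) ≠ 1 := by
    rwa [← Units.val_pow_eq_pow_val, ne_eq, Units.val_eq_one]
  by_contra h0
  exact hne (mul_right_cancel₀ h0 (by rw [one_mul, ← key]))

end DivisorData

namespace DivisorData

variable {F : Type*} [Field F]

theorem finite_deg_eq [Finite F] (n : ℕ) : {h : DivisorData F | deg h = n}.Finite := by
  obtain ⟨Φ, hΦ, -⟩ := exists_classification (F := F) n
  have : Finite ↥{h : DivisorData F | deg h = n} := Finite.of_surjective Φ hΦ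
  exact Set.toFinite _

open Classical in
theorem sum_eval_eq_sum_filter [Finite F] (χ : Fˣ →* ℂˣ) (g : Fˣ) (n : ℕ) (S : Finset ℕ+)
    (hS : ∀ e ∈ S, χ g ^ (e : ℕ) ≠ 1) :
    ∑ h ∈ (finite_deg_eq (F := F) n).toFinset, eval χ h =
      ∑ h ∈ (finite_deg_eq (F := F) n).toFinset with ∀ e ∈ S, h e = 0, eval χ h := by
  induction S using Finset.induction_on with
  | empty => simp
  | insert e S he ih =>
    rw [ih fun i hi => hS i (Finset.mem_insert_of_mem hi)]
    rw [← Finset.sum_filter_add_sum_filter_not _ (fun h : DivisorData F => h e = 0)]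
    have hz := sum_eval_eq_zero χ g e (hS e (Finset.mem_insert_self _ _))
      (({h ∈ (finite_deg_eq (F := F) n).toFinset | ∀ i ∈ S, h i = 0}).filter fun h => ¬ h e = 0) n
      (fun h => ∀ i ∈ S, h i = 0)
    rw [hz, add_zero, Finset.filter_filter]
    · congr 1
      ext h
      simp only [Finset.mem_filter, Finset.forall_mem_insert]
      tauto
    · intro h m
      refine forall₂_congr fun i hi => ?_
      rw [Finsupp.coe_update, Function.update_of_ne (by rintro rfl; exact he hi)]
    · intro h
      simp only [Finset.mem_filter, Set.Finite.mem_toFinset, Set.mem_ofPred_eq, ne_eq]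
      tauto

/-- Multiply all exponents by `d`. -/
noncomputable def scale (d : ℕ+) : DivisorData F →+ DivisorData F :=
  Finsupp.mapDomain.addMonoidHom (d * ·)

theorem scale_single (d e : ℕ+) (m : Multiset (PrimePoly F)) :
    scale d (Finsupp.single e m) = Finsupp.single (d * e) m :=
  Finsupp.mapDomain_single

theorem scale_injective (d : ℕ+) : Function.Injective (scale (F := F) d) :=
  Finsupp.mapDomain_injective (mul_right_injective d)

theorem exists_scale_eq (d : ℕ+) (h : DivisorData F) (hh : ∀ e : ℕ+, ¬ (d : ℕ) ∣ e → h e = 0) :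
    ∃ k, scale d k = h := by
  refine ⟨h.comapDomain (d * ·) (mul_right_injective d).injOn,
    Finsupp.mapDomain_comapDomain _ (mul_right_injective d) _ fun e he => ?_⟩
  by_contra hne
  refine (Finsupp.mem_support_iff.1 he) (hh e fun hd => hne ?_)
  obtain ⟨k, hk⟩ := PNat.dvd_iff.2 hd
  exact ⟨k, hk.symm⟩

theorem scale_apply_of_not_dvd (d : ℕ+) (h : DivisorData F) (e : ℕ+) (he : ¬ (d : ℕ) ∣ e) :
    scale d h e = 0 := by
  refine Finsupp.mapDomain_of_notMem_range _ _ ?_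
  rintro ⟨k, rfl⟩
  exact he (by simp)

theorem deg_scale (d : ℕ+) (h : DivisorData F) : deg (scale d h) = d * deg h := by
  induction h using Finsupp.induction_linear with
  | zero => simp
  | add h k ih ik => rw [map_add, map_add, ih, ik, map_add, mul_add]
  | single e m => rw [scale_single, deg_single, deg_single, PNat.mul_coe, mul_assoc]

theorem weight_scale (d : ℕ+) (h : DivisorData F) :
    weight (scale d h) = (d : ℕ) • weight h := by
  induction h using Finsupp.induction_linear with
  | zero => simp
  | add h k ih ik => rw [map_add, map_add, ih, ik, map_add, nsmul_add]
  | single e m => rw [scale_single, weight_single, weight_single, PNat.mul_coe, mul_smul]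

theorem eval_scale (χ : Fˣ →* ℂˣ) (d : ℕ+) (hd : ∀ u, χ u ^ (d : ℕ) = 1) (h : DivisorData F) :
    eval χ (scale d h) = 1 := by
  rw [eval, weight_scale, toMul_nsmul, map_pow, hd, Units.val_one]

theorem sum_eval [Finite F] (χ : Fˣ →* ℂˣ) (g : Fˣ) (d : ℕ+) (n : ℕ)
    (hd : ∀ u, χ u ^ (d : ℕ) = 1) (hg : ∀ e : ℕ, χ g ^ e = 1 → (d : ℕ) ∣ e) :
    ∑ h ∈ (finite_deg_eq (F := F) n).toFinset, eval χ h =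
      if (d : ℕ) ∣ n then (Nat.card {h : DivisorData F // deg h = n / d} : ℂ) else 0 := by
  classical
  set T := (finite_deg_eq (F := F) n).toFinset with hT
  let S : Finset ℕ+ := (T.biUnion Finsupp.support).filter fun e => ¬ (d : ℕ) ∣ e
  have hS : ∀ h ∈ T, (∀ e ∈ S, h e = 0) ↔ ∃ k, scale d k = h := by
    intro h hh
    constructor
    · intro h0
      refine exists_scale_eq d h fun e he => ?_
      by_contra hne
      exact hne <| h0 e <| Finset.mem_filter.2 ⟨Finset.mem_biUnion.2
        ⟨h, hh, Finsupp.mem_support_iff.2 hne⟩, he⟩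
    · rintro ⟨k, rfl⟩ e he
      exact scale_apply_of_not_dvd d k e (Finset.mem_filter.1 he).2
  rw [hT, sum_eval_eq_sum_filter χ g n S fun e he h1 => (Finset.mem_filter.1 he).2 (hg _ h1), ← hT,
    Finset.filter_congr hS]
  have hTm : ∀ k : DivisorData F, scale d k ∈ T ↔ (d : ℕ) * deg k = n := by
    intro k
    rw [hT, Set.Finite.mem_toFinset, Set.mem_ofPred_eq, deg_scale]
  split_ifs with hn
  · obtain ⟨m, rfl⟩ := hn
    rw [Nat.mul_div_cancel_left _ d.pos]
    have hset : (T.filter fun h => ∃ k, scale d k = h) =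
        (finite_deg_eq (F := F) m).toFinset.map ⟨scale d, scale_injective d⟩ := by
      ext h
      simp only [Finset.mem_filter, Finset.mem_map, Function.Embedding.coeFn_mk,
        Set.Finite.mem_toFinset, Set.mem_ofPred_eq]
      constructor
      · rintro ⟨h1, k, rfl⟩
        exact ⟨k, Nat.eq_of_mul_eq_mul_left d.pos ((hTm k).1 h1), rfl⟩
      · rintro ⟨k, rfl, rfl⟩
        exact ⟨(hTm k).2 rfl, k, rfl⟩
    rw [hset, Finset.sum_map]
    simp only [Function.Embedding.coeFn_mk, eval_scale χ d hd, Finset.sum_const, nsmul_eq_mul,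
      mul_one]
    rw [← Nat.card_eq_card_finite_toFinset]
    rfl
  · rw [Finset.filter_false_of_mem, Finset.sum_empty]
    rintro h hh ⟨k, rfl⟩
    exact hn ⟨deg k, ((hTm k).1 hh).symm⟩

end DivisorData

end GLConjugacy

theorem sum_range_pow_eq_ite {z : ℂ} {j : ℕ} (hz : z ^ j = 1) [Decidable (z = 1)] :
    ∑ a ∈ Finset.range j, z ^ a = if z = 1 then (j : ℂ) else 0 := by
  split_ifs with h
  · simp [h]
  · have := mul_geom_sum z j
    rw [hz, sub_self, mul_eq_zero, sub_eq_zero] at this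
    exact this.resolve_left h

section CommutingPairs

open Classical in
/-- The sum of `ψ x ^ a * ψ y ^ b` over the commuting pairs `(x, y)`. -/
noncomputable def commSum {G : Type*} [Group G] [Fintype G] (ψ : G →* ℂˣ) (a b : ℕ) : ℂ :=
  ∑ p : G × G with Commute p.1 p.2, (ψ p.1 : ℂ) ^ a * (ψ p.2 : ℂ) ^ b

variable {G : Type*} [Group G] [Fintype G] (ψ : G →* ℂˣ)

theorem commSum_comm (a b : ℕ) : commSum ψ a b = commSum ψ b a := by
  refine Finset.sum_equiv (Equiv.prodComm G G) (fun p => ?_) fun p _ => mul_comm _ _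
  simp [Commute.symm_iff]

open Classical in
theorem commSum_add_left (a b : ℕ) : commSum ψ (a + b) b = commSum ψ a b := by
  refine Finset.sum_equiv (Equiv.prodShear (Equiv.refl G) Equiv.mulLeft) (fun p => ?_)
    fun p _ => ?_
  · rw [Finset.mem_filter_univ, Finset.mem_filter_univ]
    simp [commute_iff_eq, mul_assoc]
  · simp only [Equiv.prodShear_apply, Equiv.refl_apply, Equiv.coe_mulLeft, map_mul, Units.val_mul]
    ring

theorem commSum_add_mul_left (a b k : ℕ) : commSum ψ (a + b * k) b = commSum ψ a b := by
  induction k with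
  | zero => simp
  | succ k ih => rw [mul_add, mul_one, ← add_assoc, commSum_add_left, ih]

theorem commSum_eq_commSum_gcd (a b : ℕ) : commSum ψ a b = commSum ψ 0 (a.gcd b) := by
  induction a, b using Nat.gcd.induction with
  | H0 b => rw [Nat.gcd_zero_left]
  | H1 a b ha ih =>
    rw [Nat.gcd_rec, ← ih, commSum_comm]
    conv_lhs => rw [← Nat.mod_add_div b a]
    exact commSum_add_mul_left ψ _ _ _

theorem card_filter_commute (y : G) [DecidableEq G] [DecidableRel (Commute (S := G))]
    [DecidableRel (IsConj (α := G))] :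
    (Finset.univ.filter fun z : G => IsConj y z).card *
      (Finset.univ.filter fun x : G => Commute x y).card = Fintype.card G := by
  rw [← Finset.card_univ, ← smul_eq_mul, ← Finset.sum_const,
    Finset.card_eq_sum_card_fiberwise (s := Finset.univ) (f := fun x : G => x * y * x⁻¹)
      (t := Finset.univ.filter fun z : G => IsConj y z)]
  · refine Finset.sum_congr rfl fun z hz => ?_
    obtain ⟨c, rfl⟩ := isConj_iff.1 (Finset.mem_filter.1 hz).2
    refine Finset.card_equiv (Equiv.mulLeft c) fun x => ?_
    rw [Finset.mem_filter_univ, Finset.mem_filter_univ, Equiv.coe_mulLeft, mul_inv_rev,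
      commute_iff_eq]
    have : c * x * y * (x⁻¹ * c⁻¹) = c * (x * y * x⁻¹) * c⁻¹ := by group
    rw [this, mul_left_inj, mul_right_inj, mul_inv_eq_iff_eq_mul]
  · intro x _
    exact Finset.mem_filter.2 ⟨Finset.mem_univ _, isConj_iff.2 ⟨x, rfl⟩⟩

open Classical in
theorem commSum_zero_left {α : Type*} (Φ : G → α) (hΦ : ∀ y z, Φ y = Φ z ↔ IsConj y z)
    (T : Finset α) (hT : ∀ t, t ∈ T ↔ ∃ y, Φ y = t) (v : α → ℂ) (c : ℕ)
    (hv : ∀ y, v (Φ y) = (ψ y : ℂ) ^ c) :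
    commSum ψ 0 c = Fintype.card G * ∑ t ∈ T, v t := by
  have h1 : commSum ψ 0 c =
      ∑ y, ((Finset.univ.filter fun x : G => Commute x y).card : ℂ) * v (Φ y) := by
    rw [commSum, Finset.sum_filter, ← Finset.univ_product_univ, Finset.sum_product_right]
    refine Finset.sum_congr rfl fun y _ => ?_
    rw [hv, ← nsmul_eq_mul, ← Finset.sum_const, Finset.sum_filter]
    simp
  rw [h1, ← Finset.sum_fiberwise_of_maps_to (g := Φ) (t := T) fun y _ => (hT _).2 ⟨y, rfl⟩,
    Finset.mul_sum]
  refine Finset.sum_congr rfl fun t ht => ?_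
  obtain ⟨y, rfl⟩ := (hT t).1 ht
  rw [← card_filter_commute y, Nat.cast_mul, mul_assoc, ← nsmul_eq_mul, ← Finset.sum_const]
  refine Finset.sum_congr (Finset.filter_congr fun z _ => eq_comm.trans (hΦ _ _)) fun z hz => ?_
  · have hyz := (hΦ y z).2 (Finset.mem_filter.1 hz).2
    rw [hyz]
    congr 2
    have h2 := card_filter_commute y
    rw [← card_filter_commute z] at h2
    have h3 : (Finset.univ.filter fun w : G => IsConj y w) =
        Finset.univ.filter fun w => IsConj z w := by
      refine Finset.filter_congr fun w _ => ?_
      rw [← hΦ, ← hΦ, hyz]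
    rw [h3] at h2
    exact (Nat.eq_of_mul_eq_mul_left (Finset.card_pos.2 ⟨z, by
      simp only [Finset.mem_filter_univ, IsConj.refl]⟩) h2).symm

open Classical in
theorem sum_commSum {j : ℕ} (hj : ∀ x, ψ x ^ j = 1) :
    ∑ a ∈ Finset.range j, ∑ b ∈ Finset.range j, commSum ψ a b =
      (j : ℂ) ^ 2 * (Nat.card (ConjClasses ψ.ker) * Nat.card ψ.ker : ℕ) := by
  have hz : ∀ x, (ψ x : ℂ) ^ j = 1 := fun x => by
    rw [← Units.val_pow_eq_pow_val, hj, Units.val_one]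
  have h1 : ∑ a ∈ Finset.range j, ∑ b ∈ Finset.range j, commSum ψ a b =
      ∑ p : G × G with Commute p.1 p.2,
        (∑ a ∈ Finset.range j, (ψ p.1 : ℂ) ^ a) * ∑ b ∈ Finset.range j, (ψ p.2 : ℂ) ^ b := by
    simp only [commSum, Finset.sum_mul_sum]
    conv_rhs => rw [Finset.sum_comm]
    exact Finset.sum_congr rfl fun a _ => Finset.sum_comm
  let e : {p : ψ.ker × ψ.ker // Commute p.1 p.2} ≃
      {p : G × G // Commute p.1 p.2 ∧ ψ p.1 = 1 ∧ ψ p.2 = 1} :=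
    { toFun p := ⟨(p.1.1, p.1.2), congrArg Subtype.val p.2.eq, p.1.1.2, p.1.2.2⟩
      invFun p := ⟨(⟨p.1.1, p.2.2.1⟩, ⟨p.1.2, p.2.2.2⟩), Subtype.ext p.2.1.eq⟩
      left_inv _ := rfl
      right_inv _ := rfl }
  rw [h1, ← card_comm_eq_card_conjClasses_mul_card, Nat.card_congr e, Nat.card_eq_fintype_card,
    Fintype.card_subtype, mul_comm, ← nsmul_eq_mul, ← Finset.sum_const, Finset.sum_filter,
    Finset.sum_filter]
  refine Finset.sum_congr rfl fun p _ => ?_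
  rw [sum_range_pow_eq_ite (hz _), sum_range_pow_eq_ite (hz _)]
  simp only [Units.val_eq_one]
  split_ifs <;> simp_all [sq]

end CommutingPairs

theorem IsCyclic.exists_monoidHom_ker_eq {A : Type*} [CommGroup A] [Finite A] [IsCyclic A]
    (D : Subgroup A) : ∃ (χ : A →* ℂˣ) (g : A), orderOf (χ g) = D.index ∧ χ.ker = D := by
  obtain ⟨q, hq⟩ := IsCyclic.exists_generator (α := A ⧸ D)
  have hj : D.index ≠ 0 := Subgroup.index_ne_zero_of_finite
  have hqo : orderOf q = D.index := orderOf_eq_card_of_forall_mem_zpowers hq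
  have hζ := Complex.isPrimitiveRoot_exp D.index hj
  obtain ⟨ζ, hζe⟩ := hζ.isUnit hj
  rw [← hζe] at hζ
  have hζo : orderOf ζ = D.index := by rw [← orderOf_units, ← hζ.eq_orderOf]
  let χ := monoidHomOfForallMemZpowers hq (g' := ζ) (by rw [hζo, hqo])
  have hχq : χ q = ζ := monoidHomOfForallMemZpowers_apply_gen hq _
  have hχ : Function.Injective χ := by
    rw [injective_iff_map_eq_one]
    intro x hx
    obtain ⟨k, rfl⟩ := Subgroup.mem_zpowers_iff.1 (hq x)
    rw [map_zpow, hχq, ← orderOf_dvd_iff_zpow_eq_one, hζo, ← hqo,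
      orderOf_dvd_iff_zpow_eq_one] at hx
    exact hx
  obtain ⟨g, hg⟩ := QuotientGroup.mk'_surjective D q
  refine ⟨χ.comp (QuotientGroup.mk' D), g, ?_, ?_⟩
  · rw [MonoidHom.comp_apply, hg, hχq, hζo]
  · rw [MonoidHom.ker_comp_of_injective _ _ hχ]
    exact QuotientGroup.ker_mk' D

section JordanTotient

theorem phi2_one : phi2 1 = 1 := by simp [phi2]

theorem phi2_mul_of_coprime {a b : ℕ} (h : a.Coprime b) : phi2 (a * b) = phi2 a * phi2 b := by
  rw [phi2, h.primeFactors_mul, Finset.prod_union h.disjoint_primeFactors, phi2, phi2]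
  push_cast
  ring

theorem phi2_prime_pow_succ {p : ℕ} (hp : p.Prime) (k : ℕ) :
    phi2 (p ^ (k + 1)) = ((p : ℚ) ^ (k + 1)) ^ 2 - ((p : ℚ) ^ k) ^ 2 := by
  have : (p : ℚ) ≠ 0 := Nat.cast_ne_zero.2 hp.ne_zero
  rw [phi2, Nat.primeFactors_prime_pow k.succ_ne_zero hp, Finset.prod_singleton]
  push_cast
  field_simp
  ring

theorem sum_divisors_phi2 (m : ℕ) : ∑ d ∈ m.divisors, phi2 d = (m : ℚ) ^ 2 := by
  induction m using Nat.recOnPrimeCoprime with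
  | zero => simp
  | prime_pow p k hp =>
    rw [Nat.sum_divisors_prime_pow hp]
    induction k with
    | zero => simp [phi2_one]
    | succ k ih =>
      rw [Finset.sum_range_succ, ih, phi2_prime_pow_succ hp]
      push_cast
      ring
  | coprime a b _ _ hab ha hb =>
    have : ∀ p ∈ a.divisors ×ˢ b.divisors, phi2 (p.1 * p.2) = phi2 p.1 * phi2 p.2 := by
      intro p hp
      rw [Finset.mem_product, Nat.mem_divisors, Nat.mem_divisors] at hp
      exact phi2_mul_of_coprime ((hab.coprime_dvd_left hp.1.1).coprime_dvd_right hp.2.1)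
    rw [Nat.divisors_mul, Finset.mul_def, Finset.sum_image hab.mul_injOn_divisors,
      Finset.sum_congr rfl this, Finset.sum_product, ← Finset.sum_mul_sum, ha, hb]
    push_cast
    ring

theorem card_pairs_div_gcd_dvd {j m : ℕ} (hj : 0 < j) (hm : m ∣ j) :
    (((Finset.range j ×ˢ Finset.range j).filter
      fun p => j / j.gcd (p.1.gcd p.2) ∣ m).card) = m ^ 2 := by
  obtain ⟨c, rfl⟩ := hm
  have hm0 : 0 < m := Nat.pos_of_mul_pos_right hj
  have hc0 : 0 < c := Nat.pos_of_mul_pos_left hj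
  have key : ((Finset.range (m * c) ×ˢ Finset.range (m * c)).filter
      fun p => m * c / (m * c).gcd (p.1.gcd p.2) ∣ m) =
      (Finset.range m ×ˢ Finset.range m).image fun p => (c * p.1, c * p.2) := by
    ext ⟨a, b⟩
    have h1 : m * c / (m * c).gcd (a.gcd b) ∣ m ↔ c ∣ a ∧ c ∣ b := by
      have hg : 0 < (m * c).gcd (a.gcd b) := Nat.gcd_pos_of_pos_left _ hj
      rw [← Nat.dvd_gcd_iff, ← Nat.mul_dvd_mul_iff_right hg,
        Nat.div_mul_cancel (Nat.gcd_dvd_left _ _), Nat.mul_dvd_mul_iff_left hm0, Nat.dvd_gcd_iff]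
      exact and_iff_right (Dvd.intro_left m rfl)
    simp only [Finset.mem_filter, Finset.mem_product, Finset.mem_range, Finset.mem_image,
      Prod.mk.injEq, Prod.exists, h1]
    constructor
    · rintro ⟨⟨ha, hb⟩, ⟨a, rfl⟩, b, rfl⟩
      rw [mul_comm m] at ha hb
      exact ⟨a, b, ⟨lt_of_mul_lt_mul_left ha (Nat.zero_le c),
        lt_of_mul_lt_mul_left hb (Nat.zero_le c)⟩, rfl, rfl⟩
    · rintro ⟨a, b, ⟨ha, hb⟩, rfl, rfl⟩
      rw [mul_comm m]
      exact ⟨⟨Nat.mul_lt_mul_of_pos_left ha hc0, Nat.mul_lt_mul_of_pos_left hb hc0⟩,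
        dvd_mul_right _ _, dvd_mul_right _ _⟩
  rw [key, Finset.card_image_of_injective, Finset.card_product, Finset.card_range, sq]
  rintro ⟨a, b⟩ ⟨a', b'⟩ h
  rw [Prod.mk.injEq] at h ⊢
  exact ⟨Nat.eq_of_mul_eq_mul_left hc0 h.1, Nat.eq_of_mul_eq_mul_left hc0 h.2⟩

theorem card_pairs_div_gcd_eq {j d : ℕ} (hj : 0 < j) (hd : d ∣ j) :
    ((((Finset.range j ×ˢ Finset.range j).filter
      fun p => j / j.gcd (p.1.gcd p.2) = d).card : ℕ) : ℚ) = phi2 d := by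
  induction d using Nat.strong_induction_on with
  | _ d ih =>
    have hd0 : d ≠ 0 := ne_zero_of_dvd_ne_zero hj.ne' hd
    have hsum : ∑ e ∈ d.divisors, ((((Finset.range j ×ˢ Finset.range j).filter
        fun p => j / j.gcd (p.1.gcd p.2) = e).card : ℕ) : ℚ) = ∑ e ∈ d.divisors, phi2 e := by
      rw [sum_divisors_phi2, ← Nat.cast_pow, ← card_pairs_div_gcd_dvd hj hd, ← Nat.cast_sum,
        Finset.card_eq_sum_card_fiberwise (f := fun p : ℕ × ℕ => j / j.gcd (p.1.gcd p.2))
          (t := d.divisors)]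
      · congr 1
        refine Finset.sum_congr rfl fun e he => congrArg _ ?_
        rw [Finset.filter_filter]
        refine Finset.filter_congr fun p _ => ⟨fun h => ⟨?_, h⟩, And.right⟩
        rw [h]
        exact Nat.dvd_of_mem_divisors he
      · intro p hp
        exact Nat.mem_divisors.2 ⟨(Finset.mem_filter.1 hp).2, hd0⟩
    rw [← Nat.cons_self_properDivisors hd0, Finset.sum_cons, Finset.sum_cons] at hsum
    rw [Finset.sum_congr rfl fun e he => ih e (Nat.mem_properDivisors.1 he).2
      ((Nat.mem_properDivisors.1 he).1.trans hd)] at hsum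
    exact add_right_cancel hsum

theorem sum_range_div_gcd {j : ℕ} (hj : 0 < j) (f : ℕ → ℚ) :
    ∑ a ∈ Finset.range j, ∑ b ∈ Finset.range j, f (j / j.gcd (a.gcd b)) =
      ∑ d ∈ j.divisors, phi2 d * f d := by
  rw [← Finset.sum_product', ← Finset.sum_fiberwise_of_maps_to
    (g := fun p : ℕ × ℕ => j / j.gcd (p.1.gcd p.2)) (t := j.divisors)]
  · refine Finset.sum_congr rfl fun d hd => ?_
    rw [← card_pairs_div_gcd_eq hj (Nat.dvd_of_mem_divisors hd), ← nsmul_eq_mul,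
      ← Finset.sum_const]
    exact Finset.sum_congr rfl fun p hp => by rw [(Finset.mem_filter.1 hp).2]
  · exact fun p _ => Nat.mem_divisors.2 ⟨Nat.div_dvd_of_dvd (Nat.gcd_dvd_left _ _), hj.ne'⟩

end JordanTotient

section GeneralLinear

open Matrix

variable {F : Type*} [Field F]

theorem DivisorData.card_conjClasses [Finite F] (n : ℕ) :
    Nat.card (ConjClasses (GL (Fin n) F)) = Nat.card {h : DivisorData F // deg h = n} := by
  obtain ⟨Φ, hΦ, hc, -⟩ := exists_classification (F := F) n
  refine Nat.card_eq_of_bijective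
    (Quotient.lift Φ fun y z h => (hc y z).2 h : ConjClasses (GL (Fin n) F) → _) ⟨?_, ?_⟩
  · rintro ⟨y⟩ ⟨z⟩ h
    exact Quotient.sound ((hc y z).1 h)
  · intro h
    obtain ⟨y, rfl⟩ := hΦ h
    exact ⟨⟦y⟧, rfl⟩

theorem DivisorData.eval_pow (χ : Fˣ →* ℂˣ) (c : ℕ) (h : DivisorData F) :
    eval (χ ^ c) h = eval χ h ^ c := by
  simp [eval]

open DivisorData in
theorem commSum_det [Finite F] (n : ℕ) [Fintype (GL (Fin n) F)] (χ : Fˣ →* ℂˣ) (g : Fˣ)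
    {j : ℕ} (hj : 0 < j) (hg : orderOf (χ g) = j) (hχ : ∀ u, χ u ^ j = 1) (a b : ℕ) :
    commSum (G := GL (Fin n) F) (χ.comp GeneralLinearGroup.det) a b =
      Fintype.card (GL (Fin n) F) * if j / j.gcd (a.gcd b) ∣ n then
        (Nat.card (ConjClasses (GL (Fin (n / (j / j.gcd (a.gcd b)))) F)) : ℂ) else 0 := by
  rw [commSum_eq_commSum_gcd]
  set c := a.gcd b
  obtain ⟨Φ, hΦ, hc, hdet⟩ := exists_classification (F := F) n
  have hpos : 0 < j / j.gcd c :=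
    Nat.div_pos (Nat.gcd_le_left _ hj) (Nat.gcd_pos_of_pos_left _ hj)
  rw [commSum_zero_left _ (fun y => (Φ y).1) (fun y z => by rw [← hc, Subtype.ext_iff])
    (finite_deg_eq (F := F) n).toFinset _ (eval (χ ^ c))]
  · rw [sum_eval (χ ^ c) g ⟨_, hpos⟩ n, PNat.mk_coe, card_conjClasses]
    · intro u
      obtain ⟨k, hk⟩ : j ∣ c * (j / j.gcd c) := by
        rw [← Nat.mul_div_assoc _ (Nat.gcd_dvd_left _ _), mul_comm,
          Nat.mul_div_assoc _ (Nat.gcd_dvd_right _ _)]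
        exact dvd_mul_right _ _
      rw [MonoidHom.pow_apply, ← pow_mul, PNat.mk_coe, hk, pow_mul, hχ, one_pow]
    · intro e he
      rw [MonoidHom.pow_apply] at he
      have := orderOf_dvd_of_pow_eq_one he
      rwa [IsOfFinOrder.orderOf_pow _ _ (orderOf_pos_iff.1 (hg ▸ hj)), hg] at this
  · intro y
    rw [eval_pow, eval, ← hdet]
    rfl
  · intro h
    rw [Set.Finite.mem_toFinset, Set.mem_ofPred_eq]
    constructor
    · intro hh
      obtain ⟨y, hy⟩ := hΦ ⟨h, hh⟩
      exact ⟨y, by rw [hy]⟩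
    · rintro ⟨y, rfl⟩
      exact (Φ y).2

end GeneralLinear

/-- Proposition 3.9: for `SL(n,q) ⊆ H ⊆ GL(n,q)` of index `j`,
`k(H) = (1/j) ∑_{d ∣ gcd(j,n)} φ₂(d) k(GL(n/d,q))`. -/
theorem stmt_9 (F : Type*) [Field F] [Fintype F] (q n : ℕ)
    (hq : Fintype.card F = q) (hn : 1 ≤ n)
    (H : Subgroup (Matrix.GeneralLinearGroup (Fin n) F))
    (hH : ∀ g : Matrix.GeneralLinearGroup (Fin n) F,
      Matrix.det (g : Matrix (Fin n) (Fin n) F) = 1 → g ∈ H) :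
    (Nat.card (ConjClasses H) : ℚ) =
      (1 / (H.index : ℚ)) *
        ∑ d ∈ (Nat.gcd H.index n).divisors,
          phi2 d * (Nat.card (ConjClasses (Matrix.GeneralLinearGroup (Fin (n / d)) F)) : ℚ) := by
  classical
  have : Nonempty (Fin n) := ⟨⟨0, hn⟩⟩
  set D := H.map (Matrix.GeneralLinearGroup.det (n := Fin n) (R := F)) with hD
  have hHD : D.comap Matrix.GeneralLinearGroup.det = H := by
    rw [hD, Subgroup.comap_map_eq, sup_eq_left]
    intro g hg
    exact hH g (congrArg Units.val hg)
  have hDi : D.index = H.index := by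
    rw [← hHD, Subgroup.index_comap_of_surjective _ Matrix.GeneralLinearGroup.det_surjective]
  obtain ⟨χ, g, hg, hker⟩ := IsCyclic.exists_monoidHom_ker_eq D
  rw [hDi] at hg
  set j := H.index with hjdef
  have hj : 0 < j := Nat.pos_of_ne_zero Subgroup.index_ne_zero_of_finite
  have hχ : ∀ u, χ u ^ j = 1 := by
    intro u
    rw [← map_pow, ← MonoidHom.mem_ker, hker, ← hDi]
    exact Subgroup.pow_index_mem D u
  have hH' : (χ.comp Matrix.GeneralLinearGroup.det).ker = H := by
    rw [← hHD, ← hker, MonoidHom.comap_ker]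
  let k : ℕ → ℚ := fun d =>
    if d ∣ n then (Nat.card (ConjClasses (Matrix.GeneralLinearGroup (Fin (n / d)) F)) : ℚ) else 0
  have hk : ∀ a b, commSum (G := Matrix.GeneralLinearGroup (Fin n) F)
      (χ.comp Matrix.GeneralLinearGroup.det) a b =
      ((Fintype.card (Matrix.GeneralLinearGroup (Fin n) F) * k (j / j.gcd (a.gcd b)) : ℚ) : ℂ) := by
    intro a b
    rw [commSum_det n χ g hj hg hχ]
    simp only [k]
    split_ifs <;> simp
  have hs := sum_commSum (G := Matrix.GeneralLinearGroup (Fin n) F)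
    (χ.comp Matrix.GeneralLinearGroup.det) (fun x => hχ _)
  have hcl : Nat.card (ConjClasses (χ.comp (Matrix.GeneralLinearGroup.det (n := Fin n))).ker) =
      Nat.card (ConjClasses H) := by rw [hH']
  rw [hcl, hH'] at hs
  simp only [hk] at hs
  have hs' : ∑ a ∈ Finset.range j, ∑ b ∈ Finset.range j,
      (Fintype.card (Matrix.GeneralLinearGroup (Fin n) F) * k (j / j.gcd (a.gcd b)) : ℚ) =
      (j : ℚ) ^ 2 * (Nat.card (ConjClasses H) * Nat.card H : ℕ) := by
    exact_mod_cast hs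
  have hcard : (Fintype.card (Matrix.GeneralLinearGroup (Fin n) F) : ℚ) = Nat.card H * j := by
    rw [← Nat.card_eq_fintype_card, ← H.card_mul_index, Nat.cast_mul]
  have hH0 : (Nat.card H : ℚ) ≠ 0 := Nat.cast_ne_zero.2 Nat.card_pos.ne'
  have hj0 : (j : ℚ) ≠ 0 := Nat.cast_ne_zero.2 hj.ne'
  simp only [← Finset.mul_sum] at hs'
  rw [sum_range_div_gcd hj, hcard] at hs'
  have hsum : ∑ d ∈ j.divisors, phi2 d * k d = ∑ d ∈ (Nat.gcd j n).divisors,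
      phi2 d * (Nat.card (ConjClasses (Matrix.GeneralLinearGroup (Fin (n / d)) F)) : ℚ) := by
    simp only [k, mul_ite, mul_zero]
    rw [← Finset.sum_filter]
    refine Finset.sum_congr ?_ fun _ _ => rfl
    ext d
    simp only [Finset.mem_filter, Nat.mem_divisors, Nat.dvd_gcd_iff]
    have := (Nat.gcd_pos_of_pos_left n hj).ne'
    have := hj.ne'
    tauto
  rw [← hsum]
  push_cast at hs'
  field_simp
  refine mul_left_cancel₀ (mul_ne_zero hH0 hj0) ?_
  linear_combination -hs'
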